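/- Let F be a field, D ≥ 1 and q ≥ 1. Let A and B be 2q × 2q matrices over R_{D−1} = F[x₁^{±1},…,x_{D−1}^{±1}] such that Q = A + x_D·B is symplectic over R_D. Let ℓ = rank B and let B₀ be a 2q × ℓ matrix over R_{D−1} whose associated linear map R_{D−1}^ℓ → R_{D−1}^{2q} is injective and whose image (column span) equals the image of B. Then the ℓ × ℓ matrix Ξ = B₀† λ_q B₀ is invertible over R_{D−1}, and det Ξ = c² for some nonzero c ∈ F. -/

import Mathlib

noncomputable section

/-- The Laurent polynomial ring in `D` variables over `F`. -/
abbrev LPoly (F : Type) [Field F] (D : ℕ) : Type := AddMonoidAlgebra F (Fin D →₀ ℤ)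

/-- The involution `x_j ↦ x_j⁻¹`, induced by negation of exponents. -/
def lstar (F : Type) [Field F] (D : ℕ) : LPoly F D ≃ₐ[F] LPoly F D :=
  AddMonoidAlgebra.domCongr F F (AddEquiv.neg (Fin D →₀ ℤ))

/-- Conjugate transpose: transpose followed by entrywise `star`. -/
def dag {F : Type} [Field F] {D : ℕ} {m n : Type} (M : Matrix m n (LPoly F D)) :
    Matrix n m (LPoly F D) := fun i j => lstar F D (M j i)

/-- The standard symplectic form `λ = [[0, I],[−I, 0]]`. -/
def lam (F : Type) [Field F] (D : ℕ) (ι : Type) [DecidableEq ι] :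
    Matrix (ι ⊕ ι) (ι ⊕ ι) (LPoly F D) :=
  Matrix.fromBlocks 0 1 (-1) 0

/-- The canonical inclusion of the Laurent polynomial ring in the first `d` variables
into the one in `d+1` variables. -/
def incl (F : Type) [Field F] (d : ℕ) : LPoly F d →+* LPoly F (d + 1) :=
  AddMonoidAlgebra.mapDomainRingHom F
    (Finsupp.mapDomain.addMonoidHom (Fin.castSucc : Fin d → Fin (d + 1)))

/-- The last variable `x_D` of `R_D` (`D = d+1`). -/
def lastVar (F : Type) [Field F] (d : ℕ) : LPoly F (d + 1) :=
  AddMonoidAlgebra.single (Finsupp.single (Fin.last d) (1 : ℤ)) (1 : F)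

/-- The `k`-th determinantal ideal of a matrix: the ideal generated by its `k × k` minors. -/
def detIdeal {R : Type} [CommRing R] {m n : Type} [Fintype m] [Fintype n]
    (M : Matrix m n R) (k : ℕ) : Ideal R :=
  Ideal.span { d | ∃ (f : Fin k → m) (g : Fin k → n),
    Function.Injective f ∧ Function.Injective g ∧ d = (M.submatrix f g).det }

/-- The rank of a matrix over an integral domain: the largest `k` whose determinantal
ideal is nonzero. -/
def matRank {R : Type} [CommRing R] {m n : Type} [Fintype m] [Fintype n]
    (M : Matrix m n R) : ℕ :=
  sSup { k | detIdeal M k ≠ ⊥ }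

/-- A skew-symmetric matrix with zero diagonal over a field has square determinant. -/
theorem exists_det_eq_sq_of_alternating {F : Type} [Field F] {n : Type} [Fintype n] [DecidableEq n]
    (M : Matrix n n F) (hskew : ∀ i j, M j i = -M i j) (hdiag : ∀ i, M i i = 0) :
    ∃ c : F, M.det = c ^ 2 := by
  induction hN : Fintype.card n using Nat.strong_induction_on generalizing n with
  | _ N ih =>
  subst hN
  by_cases hM : ∃ i j, M i j ≠ 0
  · obtain ⟨i, j, hij⟩ := hM
    have hne : i ≠ j := by rintro rfl; exact hij (hdiag i)
    let e : Fin 2 ⊕ {k // k ≠ i ∧ k ≠ j} ≃ n := Equiv.ofBijective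
      (Sum.elim ![i, j] Subtype.val) (by
        clear hskew hij ih
        constructor
        · rintro (a | ⟨a, ha, ha'⟩) (b | ⟨b, hb, hb'⟩) h
          · fin_cases a <;> fin_cases b <;> simp_all
          · fin_cases a
            · exact absurd h.symm hb
            · exact absurd h.symm hb'
          · fin_cases b
            · exact absurd h ha
            · exact absurd h ha'
          · simp_all
        · intro k
          by_cases h1 : k = i
          · exact ⟨.inl 0, by simp [h1]⟩
          by_cases h2 : k = j
          · exact ⟨.inl 1, by simp [h2]⟩
          exact ⟨.inr ⟨k, h1, h2⟩, rfl⟩)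
    have he0 : e (.inl 0) = i := rfl
    have he1 : e (.inl 1) = j := rfl
    set a := M i j with ha
    let P : Matrix (Fin 2) (Fin 2) F := !![0, a; -a, 0]
    let P' : Matrix (Fin 2) (Fin 2) F := !![0, -a⁻¹; a⁻¹, 0]
    let _ : Invertible P := invertibleOfRightInverse P P' (by
      ext k l; fin_cases k <;> fin_cases l <;> simp [P, P', hij])
    let X : Matrix (Fin 2) {k // k ≠ i ∧ k ≠ j} F :=
      Matrix.of fun k l => M (e (.inl k)) l
    let Y : Matrix {k // k ≠ i ∧ k ≠ j} (Fin 2) F :=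
      Matrix.of fun k l => M k (e (.inl l))
    let Z : Matrix {k // k ≠ i ∧ k ≠ j} {k // k ≠ i ∧ k ≠ j} F :=
      Matrix.of fun k l => M k l
    have hblock : M.submatrix e e = Matrix.fromBlocks P X Y Z := by
      ext (k | k) (l | l)
      · fin_cases k <;> fin_cases l <;> simp [P, he0, he1, hdiag, ha, hskew i j]
      · rfl
      · rfl
      · rfl
    have hinv : ⅟P = P' := rfl
    have hS : ∀ k l, (Z - Y * ⅟P * X) k l =
        M k l - a⁻¹ * (M k j * M i l - M k i * M j l) := by
      intro k l
      simp only [Matrix.sub_apply, Matrix.mul_apply, Fin.sum_univ_two, hinv, P', X, Y, Z,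
        Matrix.of_apply, he0, he1]
      simp
      ring
    obtain ⟨c, hc⟩ := ih _ (by
      refine Fintype.card_lt_of_injective_of_notMem Subtype.val Subtype.val_injective (b := i) ?_
      simp) (Z - Y * ⅟P * X) (fun k l => by
        rw [hS, hS, hskew k l, hskew k j, hskew k i, hskew l i, hskew l j]; ring)
        (fun k => by rw [hS, hdiag, hskew k j, hskew k i]; ring) rfl
    refine ⟨a * c, ?_⟩
    rw [← Matrix.det_submatrix_equiv_self e M, hblock, Matrix.det_fromBlocks₁₁, hc]
    simp [P, Matrix.det_fin_two]
    ring
  · push Not at hM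
    obtain rfl : M = 0 := by ext i j; exact hM i j
    rcases isEmpty_or_nonempty n with h | h
    · exact ⟨1, by simp⟩
    · exact ⟨0, by simp [Matrix.det_zero]⟩

theorem exists_eq_single_of_mul_eq_one {F : Type} [Field F] {G : Type} [AddCommGroup G]
    [TwoUniqueSums G] (p r : AddMonoidAlgebra F G) (h : p * r = 1) :
    ∃ (m : G) (a : F), a ≠ 0 ∧ p = AddMonoidAlgebra.single m a := by
  classical
  have hp : p ≠ 0 := by rintro rfl; simp at h
  have hr : r ≠ 0 := by rintro rfl; simp at h
  have hps : 0 < p.coeff.support.card := by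
    rw [Finset.card_pos, Finsupp.support_nonempty_iff]; simpa using hp
  have hrs : 0 < r.coeff.support.card := by
    rw [Finset.card_pos, Finsupp.support_nonempty_iff]; simpa using hr
  have hcard : p.coeff.support.card = 1 := by
    by_contra hne
    obtain ⟨x, hx, y, hy, hxy, hux, huy⟩ := TwoUniqueSums.uniqueAdd_of_one_lt_card
      (A := p.coeff.support) (B := r.coeff.support) (by
        nlinarith [show 2 ≤ p.coeff.support.card by omega])
    rw [Finset.mem_product] at hx hy
    have key : ∀ z : G × G, z.1 ∈ p.coeff.support → z.2 ∈ r.coeff.support →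
        UniqueAdd p.coeff.support r.coeff.support z.1 z.2 → z.1 + z.2 = 0 := by
      intro z h1 h2 hu
      by_contra h0
      have := AddMonoidAlgebra.coeff_mul_add_of_uniqueAdd hu
      rw [h, AddMonoidAlgebra.one_def, AddMonoidAlgebra.coeff_single,
        Finsupp.single_eq_of_ne h0] at this
      exact mul_ne_zero (Finsupp.mem_support_iff.1 h1) (Finsupp.mem_support_iff.1 h2) this.symm
    have := hux hy.1 hy.2 ((key y hy.1 hy.2 huy).trans (key x hx.1 hx.2 hux).symm)
    exact hxy (Prod.ext this.1.symm this.2.symm)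
  obtain ⟨m, a, ha, hpa⟩ := Finsupp.card_support_eq_one'.1 hcard
  exact ⟨m, a, ha, AddMonoidAlgebra.coeff_injective hpa⟩

section LaurentPolynomials

variable {F : Type} [Field F] {d : ℕ}

theorem lstar_single (m : Fin d →₀ ℤ) (a : F) :
    lstar F d (AddMonoidAlgebra.single m a) = AddMonoidAlgebra.single (-m) a := by
  simp [lstar]

theorem lstar_lstar (p : LPoly F d) : lstar F d (lstar F d p) = p := by
  ext m
  simp [lstar]

theorem lstar_incl (p : LPoly F d) :
    lstar F (d + 1) (incl F d p) = incl F d (lstar F d p) := by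
  induction p using AddMonoidAlgebra.induction_linear with
  | zero => simp
  | add p q hp hq => simp [hp, hq]
  | single m a =>
    simp only [incl, AddMonoidAlgebra.mapDomainRingHom_apply, AddMonoidAlgebra.mapDomain_single,
      lstar_single, map_neg]

theorem coeff_incl_add_single_last (p : LPoly F d) (g : Fin d →₀ ℤ) (k : ℤ) :
    (incl F d p).coeff (g.mapDomain Fin.castSucc + Finsupp.single (Fin.last d) k) =
      if k = 0 then p.coeff g else 0 := by
  have hinj := Finsupp.mapDomain_injective (M := ℤ) (Fin.castSucc_injective d)
  simp only [incl, AddMonoidAlgebra.mapDomainRingHom_apply, AddMonoidAlgebra.coeff_mapDomain]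
  split_ifs with hk
  · subst hk
    rw [Finsupp.single_zero, add_zero]
    exact Finsupp.mapDomain_apply hinj _ _
  · refine Finsupp.mapDomain_of_notMem_range _ _ ?_
    rintro ⟨g', hg'⟩
    have := DFunLike.congr_fun hg' (Fin.last d)
    have hlast : ∀ g : Fin d →₀ ℤ, g.mapDomain Fin.castSucc (Fin.last d) = 0 := fun g =>
      Finsupp.mapDomain_of_notMem_range _ _ (by rintro ⟨i, hi⟩; exact Fin.castSucc_ne_last i hi)
    simp only [Finsupp.mapDomain.addMonoidHom_apply, Finsupp.add_apply, hlast,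
      Finsupp.single_eq_same, zero_add] at this
    exact hk this.symm

theorem incl_add_lastVar_mul_incl_eq (p q r s : LPoly F d)
    (h : incl F d p + lastVar F d * incl F d q + lstar F (d + 1) (lastVar F d) * incl F d r =
      incl F d s) : p = s ∧ q = 0 ∧ r = 0 := by
  have key : ∀ (g : Fin d →₀ ℤ) (k : ℤ), (if k = 0 then p.coeff g else 0) +
      (if k - 1 = 0 then q.coeff g else 0) + (if k + 1 = 0 then r.coeff g else 0) =
      if k = 0 then s.coeff g else 0 := by
    intro g k
    have := congrArg (fun t => AddMonoidAlgebra.coeff t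
      (g.mapDomain Fin.castSucc + Finsupp.single (Fin.last d) k)) h
    simp only [lastVar, lstar_single, AddMonoidAlgebra.coeff_add, Finsupp.add_apply,
      AddMonoidAlgebra.coeff_single_mul_apply, one_mul, coeff_incl_add_single_last] at this
    have hq : -Finsupp.single (Fin.last d) 1 + (g.mapDomain Fin.castSucc +
        Finsupp.single (Fin.last d) k) =
        g.mapDomain Fin.castSucc + Finsupp.single (Fin.last d) (k - 1) := by
      rw [Finsupp.single_sub]; abel
    have hr : - -Finsupp.single (Fin.last d) 1 + (g.mapDomain Fin.castSucc +
        Finsupp.single (Fin.last d) k) =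
        g.mapDomain Fin.castSucc + Finsupp.single (Fin.last d) (k + 1) := by
      rw [Finsupp.single_add]; abel
    rwa [hq, hr, coeff_incl_add_single_last, coeff_incl_add_single_last] at this
  refine ⟨?_, ?_, ?_⟩ <;> ext g
  · simpa using key g 0
  · simpa using key g 1
  · simpa using key g (-1)

/-- Evaluation of a Laurent polynomial at `x₁ = ⋯ = x_D = 1`. -/
def evalOne (F : Type) [Field F] (d : ℕ) : LPoly F d →ₐ[F] F :=
  AddMonoidAlgebra.lift F F (Fin d →₀ ℤ) 1

theorem evalOne_lstar (p : LPoly F d) : evalOne F d (lstar F d p) = evalOne F d p := by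
  induction p using AddMonoidAlgebra.induction_linear with
  | zero => simp
  | add p q hp hq => simp [hp, hq]
  | single m a => simp [lstar_single, evalOne]

theorem dag_mul {m n l : Type} [Fintype n] (M : Matrix m n (LPoly F d))
    (N : Matrix n l (LPoly F d)) : dag (M * N) = dag N * dag M := by
  ext i j : 1
  simp [dag, Matrix.mul_apply, mul_comm]

theorem dag_dag {m n : Type} (M : Matrix m n (LPoly F d)) : dag (dag M) = M := by
  ext i j : 1
  exact lstar_lstar _

theorem dag_map_incl_add {m n : Type} (A B : Matrix m n (LPoly F d)) :
    dag (A.map (incl F d) + lastVar F d • B.map (incl F d)) =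
      (dag A).map (incl F d) + lstar F (d + 1) (lastVar F d) • (dag B).map (incl F d) := by
  ext i j : 1
  simp [dag, lstar_incl]

theorem dag_lam (ι : Type) [DecidableEq ι] : dag (lam F d ι) = -lam F d ι := by
  ext (i | i) (j | j) : 1 <;> simp [dag, lam, Matrix.one_apply, eq_comm, apply_ite (lstar F d)]

theorem lam_mul_lam (ι : Type) [DecidableEq ι] [Fintype ι] : lam F d ι * lam F d ι = -1 := by
  simp [lam, Matrix.fromBlocks_multiply, ← Matrix.fromBlocks_one, Matrix.fromBlocks_neg]

theorem lam_map_incl (ι : Type) [DecidableEq ι] :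
    (lam F d ι).map (incl F d) = lam F (d + 1) ι := by
  ext (i | i) (j | j) : 1 <;> simp [lam, Matrix.one_apply, apply_ite (incl F d)]

theorem lastVar_mul_lstar_lastVar : lastVar F d * lstar F (d + 1) (lastVar F d) = 1 := by
  simp [lastVar, lstar_single, AddMonoidAlgebra.one_def]

theorem map_incl_add_smul_eq {m n : Type} (P Q R S : Matrix m n (LPoly F d))
    (h : P.map (incl F d) + lastVar F d • Q.map (incl F d) +
      lstar F (d + 1) (lastVar F d) • R.map (incl F d) = S.map (incl F d)) :
    P = S ∧ Q = 0 ∧ R = 0 := by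
  have key : ∀ i j, P i j = S i j ∧ Q i j = 0 ∧ R i j = 0 := fun i j =>
    incl_add_lastVar_mul_incl_eq _ _ _ _ (congrFun (congrFun h i) j)
  exact ⟨Matrix.ext fun i j => (key i j).1, Matrix.ext fun i j => (key i j).2.1,
    Matrix.ext fun i j => (key i j).2.2⟩

/-- The conjugate transpose of a symplectic matrix is symplectic. -/
theorem mul_lam_mul_dag_of_dag_mul_lam_mul {ι : Type} [DecidableEq ι] [Fintype ι]
    (Q : Matrix (ι ⊕ ι) (ι ⊕ ι) (LPoly F d)) (h : dag Q * lam F d ι * Q = lam F d ι) :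
    Q * lam F d ι * dag Q = lam F d ι := by
  have h1 : -(lam F d ι * dag Q * lam F d ι) * Q = 1 := by
    rw [Matrix.neg_mul, Matrix.mul_assoc, Matrix.mul_assoc, ← Matrix.mul_assoc (dag Q), h,
      lam_mul_lam, neg_neg]
  have h2 := congrArg (· * lam F d ι) (mul_eq_one_comm.1 h1)
  simp only [Matrix.mul_neg, Matrix.neg_mul, Matrix.mul_assoc, lam_mul_lam, Matrix.mul_one,
    neg_neg, Matrix.one_mul] at h2
  rw [Matrix.mul_assoc, h2]

/-- The boundary terms of a symplectic matrix `A + x_D B`. -/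
theorem boundary_mul_lam_mul {ι : Type} [DecidableEq ι] [Fintype ι]
    (A B : Matrix (ι ⊕ ι) (ι ⊕ ι) (LPoly F d))
    (hQ : dag (A.map (incl F d) + lastVar F d • B.map (incl F d)) *
        lam F (d + 1) ι * (A.map (incl F d) + lastVar F d • B.map (incl F d)) =
        lam F (d + 1) ι) :
    B * lam F d ι * dag B * lam F d ι * B = -B := by
  have hx := lastVar_mul_lstar_lastVar (F := F) (d := d)
  have hx' := (mul_comm _ _).trans hx
  have hQ' := mul_lam_mul_dag_of_dag_mul_lam_mul _ hQ
  rw [dag_map_incl_add, ← lam_map_incl] at hQ hQ'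
  obtain ⟨h1, -, -⟩ := map_incl_add_smul_eq (dag A * lam F d ι * A + dag B * lam F d ι * B)
    (dag A * lam F d ι * B) (dag B * lam F d ι * A) (lam F d ι) (by
      rw [← hQ]
      simp only [Matrix.map_mul, Matrix.map_add _ (map_add (incl F d)), Matrix.add_mul,
        Matrix.mul_add, Matrix.smul_mul, Matrix.mul_smul, smul_add, smul_smul, hx, one_smul]
      abel)
  obtain ⟨-, h2, -⟩ := map_incl_add_smul_eq (A * lam F d ι * dag A + B * lam F d ι * dag B)
    (B * lam F d ι * dag A) (A * lam F d ι * dag B) (lam F d ι) (by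
      rw [← hQ']
      simp only [Matrix.map_mul, Matrix.map_add _ (map_add (incl F d)), Matrix.add_mul,
        Matrix.mul_add, Matrix.smul_mul, Matrix.mul_smul, smul_add, smul_smul, hx', one_smul]
      abel)
  calc B * lam F d ι * dag B * lam F d ι * B
      = B * lam F d ι * dag A * (lam F d ι * A) + B * lam F d ι * (dag B * lam F d ι * B) := by
        rw [h2]; simp only [Matrix.zero_mul, zero_add, Matrix.mul_assoc]
    _ = B * lam F d ι * (dag A * lam F d ι * A + dag B * lam F d ι * B) := by
        simp only [Matrix.mul_add, Matrix.mul_assoc]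
    _ = -B := by rw [h1, Matrix.mul_assoc, lam_mul_lam, Matrix.mul_neg, Matrix.mul_one]

/-- Over a Laurent polynomial ring, a unit `p` with `p† = ± p` is a nonzero constant. -/
theorem eq_algebraMap_of_mul_eq_one_of_lstar_eq (p r : LPoly F d) (h : p * r = 1)
    (hp : lstar F d p = p ∨ lstar F d p = -p) :
    ∃ a : F, a ≠ 0 ∧ p = algebraMap F (LPoly F d) a := by
  obtain ⟨m, a, ha, rfl⟩ := exists_eq_single_of_mul_eq_one p r h
  rw [lstar_single] at hp
  have hm : m = 0 := by
    have : -m = m := by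
      by_contra hne
      rcases hp with hp | hp
      · exact hne ((AddMonoidAlgebra.single_left_inj ha).1 hp)
      · have := congrArg (fun t => AddMonoidAlgebra.coeff t m) hp
        simp [Finsupp.single_eq_of_ne (Ne.symm hne), ha] at this
    ext i
    have := DFunLike.congr_fun this i
    simp only [Finsupp.coe_neg, Pi.neg_apply, Finsupp.coe_zero, Pi.zero_apply] at this ⊢
    omega
  subst hm
  exact ⟨a, ha, rfl⟩

theorem dag_mul_lam_mul {ι κ : Type} [DecidableEq ι] [Fintype ι]
    (N : Matrix (ι ⊕ ι) κ (LPoly F d)) :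
    dag (dag N * lam F d ι * N) = -(dag N * lam F d ι * N) := by
  rw [dag_mul, dag_mul, dag_dag, dag_lam, Matrix.neg_mul, Matrix.mul_neg, Matrix.mul_assoc]

theorem lstar_det {κ : Type} [Fintype κ] [DecidableEq κ] (M : Matrix κ κ (LPoly F d)) :
    lstar F d M.det = (dag M).det := by
  rw [← Matrix.det_transpose (dag M), AlgEquiv.map_det]
  rfl

/-- The value at `x₁ = ⋯ = x_D = 1` of the determinant of a Gram matrix of `λ` is a square. -/
theorem exists_evalOne_det_eq_sq {ι κ : Type} [DecidableEq ι] [Fintype ι] [Fintype κ]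
    [DecidableEq κ] (N : Matrix (ι ⊕ ι) κ (LPoly F d)) :
    ∃ c : F, evalOne F d (dag N * lam F d ι * N).det = c ^ 2 := by
  rw [AlgHom.map_det]
  refine exists_det_eq_sq_of_alternating _ (fun i j => ?_) (fun i => ?_)
  · have := congrArg (evalOne F d) (congrFun (congrFun (dag_mul_lam_mul N) i) j)
    rw [dag, evalOne_lstar] at this
    simpa using this
  · simp [Matrix.mul_apply, dag, evalOne_lstar, lam, Matrix.one_apply, mul_comm]

theorem exists_mul_eq_of_range_le {m n l : Type} [Fintype n] [Fintype l] [DecidableEq l]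
    {R : Type} [CommRing R] (M : Matrix m n R) (N : Matrix m l R)
    (h : LinearMap.range N.mulVecLin ≤ LinearMap.range M.mulVecLin) :
    ∃ C : Matrix n l R, M * C = N := by
  have : ∀ j, ∃ v, M.mulVec v = N.col j := fun j => by
    obtain ⟨v, hv⟩ := h ⟨Pi.single j 1, rfl⟩
    exact ⟨v, by simpa using hv⟩
  choose v hv using this
  refine ⟨Matrix.of fun i j => v j i, ?_⟩
  ext i j
  exact congrFun (hv j) i

theorem mul_left_cancel_of_mulVecLin_injective {m n l : Type} [Fintype n] {R : Type} [CommRing R]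
    {M : Matrix m n R} (hM : Function.Injective M.mulVecLin) {X Y : Matrix n l R}
    (h : M * X = M * Y) : X = Y := by
  ext i j
  exact congrFun (hM (a₁ := X.col j) (a₂ := Y.col j) (funext fun k => congrFun (congrFun h k) j)) i

theorem exists_mul_dag_mul_lam_mul_eq_one {ι κ : Type} [DecidableEq ι] [Fintype ι] [Fintype κ]
    [DecidableEq κ] (B : Matrix (ι ⊕ ι) (ι ⊕ ι) (LPoly F d)) (B₀ : Matrix (ι ⊕ ι) κ (LPoly F d))
    (hinj : Function.Injective B₀.mulVecLin)
    (hrange : LinearMap.range B₀.mulVecLin = LinearMap.range B.mulVecLin)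
    (hB : B * lam F d ι * dag B * lam F d ι * B = -B) :
    ∃ T : Matrix κ κ (LPoly F d), T * (dag B₀ * lam F d ι * B₀) = 1 := by
  obtain ⟨C, hC⟩ := exists_mul_eq_of_range_le B₀ B hrange.ge
  obtain ⟨E, hE⟩ := exists_mul_eq_of_range_le B B₀ hrange.le
  have hCE : C * E = 1 := mul_left_cancel_of_mulVecLin_injective hinj (by
    rw [← Matrix.mul_assoc, hC, hE, Matrix.mul_one])
  refine ⟨-(C * lam F d ι * dag C), mul_left_cancel_of_mulVecLin_injective hinj ?_⟩
  have := congrArg (fun M => -(M * E)) hB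
  rw [← hC, dag_mul] at this
  simpa only [Matrix.mul_assoc, hCE, Matrix.mul_one, Matrix.neg_mul, Matrix.mul_neg,
    neg_neg] using this

end LaurentPolynomials

/-- for `Q = A + x_D·B` symplectic, a free basis `B₀` of the column span of
`B` yields an invertible antihermitian form `Ξ = B₀† λ B₀` whose determinant is a nonzero
square in `F`. -/
theorem boundary_antihermitian_form_invertible_and_det_square
    (F : Type) [Field F] (d : ℕ) (q : ℕ) (hq : 0 < q)
    (A B : Matrix (Fin q ⊕ Fin q) (Fin q ⊕ Fin q) (LPoly F d))
    (hQ : dag (A.map (incl F d) + lastVar F d • B.map (incl F d)) *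
        lam F (d + 1) (Fin q) * (A.map (incl F d) + lastVar F d • B.map (incl F d)) =
        lam F (d + 1) (Fin q))
    (B₀ : Matrix (Fin q ⊕ Fin q) (Fin (matRank B)) (LPoly F d))
    (hinj : Function.Injective B₀.mulVecLin)
    (hrange : LinearMap.range B₀.mulVecLin = LinearMap.range B.mulVecLin) :
    IsUnit (dag B₀ * lam F d (Fin q) * B₀) ∧
    ∃ c : F, c ≠ 0 ∧
      (dag B₀ * lam F d (Fin q) * B₀).det = algebraMap F (LPoly F d) (c ^ 2) := by
  obtain ⟨T, hinv⟩ := exists_mul_dag_mul_lam_mul_eq_one B B₀ hinj hrange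
    (boundary_mul_lam_mul A B hQ)
  have hinv' := mul_eq_one_comm.1 hinv
  have hdet := congrArg Matrix.det hinv'
  rw [Matrix.det_mul, Matrix.det_one] at hdet
  refine ⟨IsUnit.of_mul_eq_one _ hinv', ?_⟩
  obtain ⟨a, ha, hΞ⟩ := eq_algebraMap_of_mul_eq_one_of_lstar_eq _ _ hdet (by
    rw [lstar_det, dag_mul_lam_mul, Matrix.det_neg]
    rcases neg_one_pow_eq_or (LPoly F d) (Fintype.card (Fin (matRank B))) with h | h
    · left; rw [h, one_mul]
    · right; rw [h, neg_one_mul])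
  obtain ⟨c, hc⟩ := exists_evalOne_det_eq_sq B₀
  rw [hΞ, AlgHom.commutes, Algebra.algebraMap_self_apply] at hc
  refine ⟨c, ?_, by rw [hΞ, hc]⟩
  rintro rfl
  exact ha (by simpa using hc)
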